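/- arXiv:2209.00035 — 2 statements merged into one kernel-verified Lean document; each statement's English description precedes it below -/
import Mathlib

section
/- Let β > 0, λ ∈ ℝ, and x, y ∈ ℝ be such that λ(e^{2πx/β} − 1) + 2π/β ≠ 0, λ(e^{2πy/β} − 1) + 2π/β ≠ 0, 1 + A_β(λ,x) > 0, and 1 + A_β(λ,y) > 0. Then sinh²( (π/β)·(α_β(λ,x) − α_β(λ,y)) ) = Y_β(λ,x)·Y_β(λ,y)·sinh²( (π/β)·(x − y) ), where Y_β(λ,x) = 4π²β(λ² + 1)e^{2πx/β} / [ (βλ(e^{2πx/β} − 1) + 2π)·(β(βλ + 2π)e^{2πx/β} − (β² + 4π²)λ) ]. In other words, the thermal rotation is compatible with the thermal two-point kernel sinh^{−2}((π/β)(x − y)). -/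
open Real

/-- The function `A_β(λ,x)` of the thermal rotation. -/
noncomputable def Abeta (β lam x : ℝ) : ℝ :=
  (2 * π / β) * (Real.exp (2 * π * x / β) - 1 - (2 * π / β) * lam) /
    (lam * (Real.exp (2 * π * x / β) - 1) + 2 * π / β)

/-- The thermal rotation `α_β(λ,x)`. -/
noncomputable def alphaBeta (β lam x : ℝ) : ℝ :=
  (β / (2 * π)) * Real.log (1 + Abeta β lam x)

/-- The Jacobian factor `Y_β(λ,x)` of the thermal rotation. -/
noncomputable def Ybeta (β lam x : ℝ) : ℝ :=
  4 * π ^ 2 * β * (lam ^ 2 + 1) * Real.exp (2 * π * x / β) /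
    ((β * lam * (Real.exp (2 * π * x / β) - 1) + 2 * π) *
      (β * (β * lam + 2 * π) * Real.exp (2 * π * x / β) - (β ^ 2 + 4 * π ^ 2) * lam))

theorem sinh_half_log_sub_log_sq {U V : ℝ} (hU : 0 < U) (hV : 0 < V) :
    Real.sinh ((Real.log U - Real.log V) / 2) ^ 2 = (U - V) ^ 2 / (4 * U * V) := by
  have hcosh := Real.cosh_two_mul ((Real.log U - Real.log V) / 2)
  rw [Real.cosh_sq, mul_div_cancel₀ _ two_ne_zero, Real.cosh_eq, neg_sub,
    Real.exp_sub, Real.exp_sub, Real.exp_log hU, Real.exp_log hV] at hcosh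
  have h : Real.sinh ((Real.log U - Real.log V) / 2) ^ 2 = ((U / V + V / U) / 2 - 1) / 2 := by
    linarith
  rw [h]
  field_simp
  ring

theorem one_add_Abeta {β lam x : ℝ}
    (hden : lam * (Real.exp (2 * π * x / β) - 1) + 2 * π / β ≠ 0) :
    1 + Abeta β lam x =
      ((lam + 2 * π / β) * Real.exp (2 * π * x / β) - (1 + (2 * π / β) ^ 2) * lam) /
        (lam * (Real.exp (2 * π * x / β) - 1) + 2 * π / β) := by
  rw [Abeta, eq_div_iff hden, add_mul, div_mul_cancel₀ _ hden]
  ring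

theorem Ybeta_eq {β : ℝ} (hβ : β ≠ 0) (lam x : ℝ) :
    Ybeta β lam x = (2 * π / β) ^ 2 * (lam ^ 2 + 1) * Real.exp (2 * π * x / β) /
      ((lam * (Real.exp (2 * π * x / β) - 1) + 2 * π / β) *
        ((lam + 2 * π / β) * Real.exp (2 * π * x / β) - (1 + (2 * π / β) ^ 2) * lam)) := by
  refine Eq.trans ?_ (mul_div_mul_left _ _ (pow_ne_zero 3 hβ))
  rw [Ybeta]
  congr 1 <;> field_simp <;> ring

/-- The Möbius map `u ↦ ((l + c) u - (1 + c²) l) / (l (u - 1) + c)` preserves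
`(u - v)² / (4 u v)` up to a factor depending on `u` times the same factor depending on `v`. -/
theorem moebius_kernel {c l u v : ℝ} (hu : u ≠ 0) (hv : v ≠ 0)
    (hDu : l * (u - 1) + c ≠ 0) (hDv : l * (v - 1) + c ≠ 0)
    (hNu : (l + c) * u - (1 + c ^ 2) * l ≠ 0) (hNv : (l + c) * v - (1 + c ^ 2) * l ≠ 0) :
    (((l + c) * u - (1 + c ^ 2) * l) / (l * (u - 1) + c) -
        ((l + c) * v - (1 + c ^ 2) * l) / (l * (v - 1) + c)) ^ 2 /
      (4 * (((l + c) * u - (1 + c ^ 2) * l) / (l * (u - 1) + c)) *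
        (((l + c) * v - (1 + c ^ 2) * l) / (l * (v - 1) + c))) =
    c ^ 2 * (l ^ 2 + 1) * u / ((l * (u - 1) + c) * ((l + c) * u - (1 + c ^ 2) * l)) *
      (c ^ 2 * (l ^ 2 + 1) * v / ((l * (v - 1) + c) * ((l + c) * v - (1 + c ^ 2) * l))) *
      ((u - v) ^ 2 / (4 * u * v)) := by
  have hdet : ((l + c) * u - (1 + c ^ 2) * l) * (l * (v - 1) + c) -
      (l * (u - 1) + c) * ((l + c) * v - (1 + c ^ 2) * l) = c ^ 2 * (l ^ 2 + 1) * (u - v) := by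
    ring
  rw [div_sub_div _ _ hDu hDv, hdet]
  generalize (l + c) * u - (1 + c ^ 2) * l = Nu at *
  generalize (l + c) * v - (1 + c ^ 2) * l = Nv at *
  generalize l * (u - 1) + c = Du at *
  generalize l * (v - 1) + c = Dv at *
  field_simp

theorem stmt6 (β : ℝ) (hβ : 0 < β) (lam x y : ℝ)
    (hdenx : lam * (Real.exp (2 * π * x / β) - 1) + 2 * π / β ≠ 0)
    (hdeny : lam * (Real.exp (2 * π * y / β) - 1) + 2 * π / β ≠ 0)
    (hposx : 0 < 1 + Abeta β lam x)
    (hposy : 0 < 1 + Abeta β lam y) :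
    Real.sinh ((π / β) * (alphaBeta β lam x - alphaBeta β lam y)) ^ 2 =
      Ybeta β lam x * Ybeta β lam y * Real.sinh ((π / β) * (x - y)) ^ 2 := by
  have hl : (π / β) * (alphaBeta β lam x - alphaBeta β lam y) =
      (Real.log (1 + Abeta β lam x) - Real.log (1 + Abeta β lam y)) / 2 := by
    have := Real.pi_ne_zero
    unfold alphaBeta
    field_simp
  have hr : (π / β) * (x - y) = (Real.log (Real.exp (2 * π * x / β)) -
      Real.log (Real.exp (2 * π * y / β))) / 2 := by
    rw [Real.log_exp, Real.log_exp]
    ring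
  rw [hl, hr, sinh_half_log_sub_log_sq hposx hposy,
    sinh_half_log_sub_log_sq (Real.exp_pos _) (Real.exp_pos _), Ybeta_eq hβ.ne', Ybeta_eq hβ.ne']
  rw [one_add_Abeta hdenx] at hposx ⊢
  rw [one_add_Abeta hdeny] at hposy ⊢
  exact moebius_kernel (Real.exp_ne_zero _) (Real.exp_ne_zero _) hdenx hdeny
    (div_ne_zero_iff.mp hposx.ne').1 (div_ne_zero_iff.mp hposy.ne').1
end

section
/- Let β > 0, let f : ℝ → ℝ be smooth with compact support, let c ∈ ℝ, and for L > 0 set a = c − L/2, b = c + L/2, and S_β(L) = 2β·∫_a^b ( sinh(π(x−a)/β)·sinh(π(b−x)/β)/sinh(πL/β) )·f'(x)² dx. Then S_β is twice differentiable on (0,∞) and S_β''(L) ≥ −( π²/( β·sinh³(πL/β) ) )·∫_a^b [ (cosh(πL/β) − 1)² + 2·sinh²(π(x − c)/β)·(1 + cosh²(πL/β)) ]·f'(x)² dx. -/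
open Real intervalIntegral

/-- Relative entropy of the interval `(c - L/2, c + L/2)` for the coherent state
generated by `f` with respect to the thermal state at inverse temperature `β`
in the U(1)-current model. -/
noncomputable def Sth (β : ℝ) (f : ℝ → ℝ) (c L : ℝ) : ℝ :=
  2 * β * ∫ x in (c - L / 2)..(c + L / 2),
    (Real.sinh (π * (x - (c - L / 2)) / β) * Real.sinh (π * ((c + L / 2) - x) / β) /
      Real.sinh (π * L / β)) * (deriv f x) ^ 2

theorem hasDerivAt_integral_symm_interval {h : ℝ → ℝ} (hh : Continuous h) (c L : ℝ) :
    HasDerivAt (fun M => ∫ x in (c - M / 2)..(c + M / 2), h x)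
      ((h (c + L / 2) + h (c - L / 2)) / 2) L := by
  have hF (y : ℝ) : HasDerivAt (fun y => ∫ x in (0 : ℝ)..y, h x) (h y) y :=
    hh.integral_hasStrictDerivAt 0 y |>.hasDerivAt
  have hhalf : HasDerivAt (fun M : ℝ => M / 2) (1 / 2) L := (hasDerivAt_id L).div_const 2
  have hr := (hF (c + L / 2)).comp L (hhalf.const_add c)
  have hl := (hF (c - L / 2)).comp L (hhalf.const_sub c)
  have hsub : (fun M => ∫ x in (c - M / 2)..(c + M / 2), h x) =
      ((fun y => ∫ x in (0 : ℝ)..y, h x) ∘ fun M => c + M / 2) -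
        ((fun y => ∫ x in (0 : ℝ)..y, h x) ∘ fun M => c - M / 2) := by
    funext M
    exact (integral_interval_sub_left (hh.intervalIntegrable _ _)
      (hh.intervalIntegrable _ _)).symm
  rw [hsub]
  exact (hr.sub hl).congr_deriv (by ring)

theorem sinh_mul_sinh_eq (a b : ℝ) :
    Real.sinh a * Real.sinh b = (Real.cosh (a + b) - Real.cosh (a - b)) / 2 := by
  rw [Real.cosh_add, Real.cosh_sub]
  ring

theorem Sth_eq {β : ℝ} {f : ℝ → ℝ} (hg : Continuous (deriv f)) (c L : ℝ) :
    Sth β f c L = β * ((Real.cosh (π * L / β) *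
        (∫ x in (c - L / 2)..(c + L / 2), deriv f x ^ 2) -
      ∫ x in (c - L / 2)..(c + L / 2),
        Real.cosh (2 * (π * (x - c) / β)) * deriv f x ^ 2) / Real.sinh (π * L / β)) := by
  have hA : IntervalIntegrable (fun x => Real.cosh (π * L / β) * deriv f x ^ 2)
      MeasureTheory.volume (c - L / 2) (c + L / 2) :=
    Continuous.intervalIntegrable (by fun_prop) _ _
  have hB : IntervalIntegrable (fun x => Real.cosh (2 * (π * (x - c) / β)) * deriv f x ^ 2)
      MeasureTheory.volume (c - L / 2) (c + L / 2) :=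
    Continuous.intervalIntegrable (by fun_prop) _ _
  rw [Sth, ← integral_const_mul (Real.cosh (π * L / β)), ← integral_sub hA hB, ← integral_div,
    ← integral_const_mul, ← integral_const_mul]
  congr 1
  funext x
  rw [sinh_mul_sinh_eq,
    show π * (x - (c - L / 2)) / β + π * ((c + L / 2) - x) / β = π * L / β by ring,
    show π * (x - (c - L / 2)) / β - π * ((c + L / 2) - x) / β
      = 2 * (π * (x - c) / β) by ring]
  ring

theorem hasDerivAt_integral_cosh_mul {β : ℝ} {f : ℝ → ℝ} (hg : Continuous (deriv f))
    (c L : ℝ) :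
    HasDerivAt (fun M => ∫ x in (c - M / 2)..(c + M / 2),
        Real.cosh (2 * (π * (x - c) / β)) * deriv f x ^ 2)
      (Real.cosh (π * L / β) *
        ((deriv f (c + L / 2) ^ 2 + deriv f (c - L / 2) ^ 2) / 2)) L := by
  have h := hasDerivAt_integral_symm_interval
    (h := fun x => Real.cosh (2 * (π * (x - c) / β)) * deriv f x ^ 2) (by fun_prop) c L
  refine h.congr_deriv ?_
  rw [show 2 * (π * (c + L / 2 - c) / β) = π * L / β by ring,
    show 2 * (π * (c - L / 2 - c) / β) = -(π * L / β) by ring, Real.cosh_neg]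
  ring

theorem hasDerivAt_Sth {β : ℝ} (hβ : 0 < β) {f : ℝ → ℝ} (hg : Continuous (deriv f))
    (c : ℝ) {L : ℝ} (hL : 0 < L) :
    HasDerivAt (fun M => Sth β f c M)
      (π * ((Real.cosh (π * L / β) * (∫ x in (c - L / 2)..(c + L / 2),
          Real.cosh (2 * (π * (x - c) / β)) * deriv f x ^ 2) -
        ∫ x in (c - L / 2)..(c + L / 2), deriv f x ^ 2) / Real.sinh (π * L / β) ^ 2)) L := by
  have hs : 0 < Real.sinh (π * L / β) := Real.sinh_pos_iff.2 (by positivity)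
  have hk : HasDerivAt (fun M : ℝ => π * M / β) (π / β) L :=
    (((hasDerivAt_id L).const_mul π).div_const β).congr_deriv (by ring)
  have hA := hasDerivAt_integral_symm_interval (hg.pow 2) c L
  have hB := hasDerivAt_integral_cosh_mul (β := β) hg c L
  rw [funext fun M => Sth_eq (β := β) hg c M]
  refine ((((hk.cosh.mul hA).sub hB).div hk.sinh hs.ne').const_mul β).congr_deriv ?_
  simp only [Pi.mul_apply, Pi.sub_apply, Pi.pow_apply]
  have h := Real.cosh_sq (π * L / β)
  generalize (∫ x in (c - L / 2)..(c + L / 2), deriv f x ^ 2) = A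
  generalize (∫ x in (c - L / 2)..(c + L / 2),
    Real.cosh (2 * (π * (x - c) / β)) * deriv f x ^ 2) = B
  generalize Real.cosh (π * L / β) = C at *
  generalize Real.sinh (π * L / β) = S at *
  generalize deriv f (c + L / 2) = p
  generalize deriv f (c - L / 2) = q
  field_simp
  linear_combination (-2 * A * π) * h

theorem hasDerivAt_deriv_Sth {β : ℝ} (hβ : 0 < β) {f : ℝ → ℝ} (hg : Continuous (deriv f))
    (c : ℝ) {L : ℝ} (hL : 0 < L) :
    HasDerivAt (deriv fun M => Sth β f c M)
      (π ^ 2 / (β * Real.sinh (π * L / β) ^ 3) *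
        (2 * Real.cosh (π * L / β) * (∫ x in (c - L / 2)..(c + L / 2), deriv f x ^ 2) -
          (1 + Real.cosh (π * L / β) ^ 2) * ∫ x in (c - L / 2)..(c + L / 2),
            Real.cosh (2 * (π * (x - c) / β)) * deriv f x ^ 2) +
        π * ((deriv f (c + L / 2) ^ 2 + deriv f (c - L / 2) ^ 2) / 2)) L := by
  have hs : 0 < Real.sinh (π * L / β) := Real.sinh_pos_iff.2 (by positivity)
  have hk : HasDerivAt (fun M : ℝ => π * M / β) (π / β) L :=
    (((hasDerivAt_id L).const_mul π).div_const β).congr_deriv (by ring)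
  have hA := hasDerivAt_integral_symm_interval (hg.pow 2) c L
  have hB := hasDerivAt_integral_cosh_mul (β := β) hg c L
  refine HasDerivAt.congr_of_eventuallyEq (HasDerivAt.congr_deriv
    ((((hk.cosh.mul hB).sub hA).div (hk.sinh.pow 2) (pow_ne_zero 2 hs.ne')).const_mul π) ?_)
    (Filter.eventually_of_mem (Ioi_mem_nhds hL) fun M hM => (hasDerivAt_Sth hβ hg c hM).deriv)
  simp only [Pi.mul_apply, Pi.sub_apply, Pi.pow_apply]
  have h := Real.cosh_sq (π * L / β)
  generalize (∫ x in (c - L / 2)..(c + L / 2), deriv f x ^ 2) = A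
  generalize (∫ x in (c - L / 2)..(c + L / 2),
    Real.cosh (2 * (π * (x - c) / β)) * deriv f x ^ 2) = B
  generalize Real.cosh (π * L / β) = C at *
  generalize Real.sinh (π * L / β) = S at *
  generalize deriv f (c + L / 2) = p
  generalize deriv f (c - L / 2) = q
  field_simp
  linear_combination S * (β * S * (p ^ 2 + q ^ 2) - 2 * π * B) * h

theorem stmt19 (β : ℝ) (hβ : 0 < β)
    (f : ℝ → ℝ) (hf : ContDiff ℝ (⊤ : ℕ∞) f) (hfc : HasCompactSupport f) (c : ℝ) :
    ∀ L : ℝ, 0 < L →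
      DifferentiableAt ℝ (fun M => Sth β f c M) L ∧
      DifferentiableAt ℝ (deriv (fun M => Sth β f c M)) L ∧
      deriv (deriv (fun M => Sth β f c M)) L ≥
        -(π ^ 2 / (β * Real.sinh (π * L / β) ^ 3)) *
          ∫ x in (c - L / 2)..(c + L / 2),
            ((Real.cosh (π * L / β) - 1) ^ 2 +
              2 * Real.sinh (π * (x - c) / β) ^ 2 *
                (1 + Real.cosh (π * L / β) ^ 2)) * (deriv f x) ^ 2 := by
  intro L hL
  have hg : Continuous (deriv f) := hf.continuous_deriv (by simp)
  have h2 := hasDerivAt_deriv_Sth hβ hg c hL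
  refine ⟨(hasDerivAt_Sth hβ hg c hL).differentiableAt, h2.differentiableAt, ?_⟩
  have hA : IntervalIntegrable (fun x => 2 * Real.cosh (π * L / β) * deriv f x ^ 2)
      MeasureTheory.volume (c - L / 2) (c + L / 2) :=
    Continuous.intervalIntegrable (by fun_prop) _ _
  have hB : IntervalIntegrable (fun x => (1 + Real.cosh (π * L / β) ^ 2) *
        (Real.cosh (2 * (π * (x - c) / β)) * deriv f x ^ 2))
      MeasureTheory.volume (c - L / 2) (c + L / 2) :=
    Continuous.intervalIntegrable (by fun_prop) _ _
  have hI : -(∫ x in (c - L / 2)..(c + L / 2),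
      ((Real.cosh (π * L / β) - 1) ^ 2 + 2 * Real.sinh (π * (x - c) / β) ^ 2 *
        (1 + Real.cosh (π * L / β) ^ 2)) * (deriv f x) ^ 2) =
      2 * Real.cosh (π * L / β) * (∫ x in (c - L / 2)..(c + L / 2), deriv f x ^ 2) -
        (1 + Real.cosh (π * L / β) ^ 2) * ∫ x in (c - L / 2)..(c + L / 2),
          Real.cosh (2 * (π * (x - c) / β)) * deriv f x ^ 2 := by
    rw [← integral_const_mul, ← integral_const_mul, ← integral_sub hA hB, ← integral_neg]
    congr 1
    funext x
    rw [Real.cosh_two_mul, Real.cosh_sq (π * (x - c) / β)]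
    ring
  rw [h2.deriv, neg_mul_comm, hI]
  exact le_add_of_nonneg_right (by positivity)
end
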